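/- arXiv:1503.02210 — 3 statements merged into one kernel-verified Lean document; each statement's English description precedes it below -/
import Mathlib

section
/- Encoding of negated labels into CTP: let φ and ψ be CTP^¬ node formulas whose labels and negated labels are among p₁,¬p₁,…,p_n,¬p_n, let s be a fresh label, let ζ := ⟨↓⟩(s ∧ ⋀_{i≤n}⟨↓⁺⟩p_i), and define the translation (·)• by ⊤• = ζ; (p_i)• = ζ∧⟨↓⟩(s∧⟨↓⟩p_i); (¬p_i)• = ζ∧⟨↓⟩(s∧⟨↓⟩⟨↓⁺⟩p_i); (θ∧σ)• = θ•∧σ•; (⟨↓⟩θ)• = ζ∧⟨↓⟩θ•; (U(θ,σ))• = ζ∧U(θ•,σ•). Let AX be the disjunction of (1) ⟨↓*⟩(s∧⟨↓*⟩ζ), (2) ⋁_{i≤n}⟨↓*⟩((p_i)•∧(¬p_i)•), and (3) ⋁_{i≠j}⟨↓*⟩((p_i)•∧(p_j)•), where ⟨↓*⟩χ abbreviates χ∨⟨↓⁺⟩χ. Then: (a) φ is contained in ψ over single-labeled trees if and only if φ• is contained in ψ•∨AX over single-labeled trees; (b) φ is contained in ψ over multi-labeled trees if and only if φ• is contained in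 ψ•∨(1)∨(2) over multi-labeled trees. -/
/- Trees over a label alphabet -/
structure RTree (A : Type) where
  Node : Type
  E : Node → Node → Prop
  root : Node
  label : Node → Set A

namespace RTree
variable {A : Type}

/-- Tree axioms not requiring finiteness of the node set: finite label sets,
    connectedness from the root, unique parents, acyclicity. -/
def IsPreTree (T : RTree A) : Prop :=
  (∀ n, (T.label n).Finite) ∧
  (∀ n, Relation.ReflTransGen T.E T.root n) ∧
  (∀ n m m', T.E m n → T.E m' n → m = m') ∧
  (∀ n, ¬ Relation.TransGen T.E n n)

/-- A (finite, rooted, unranked) tree. -/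
def IsTree (T : RTree A) : Prop := T.IsPreTree ∧ Finite T.Node

/-- Single-labeled (XML) trees: every node carries exactly one label. -/
def SingleLabeled (T : RTree A) : Prop := ∀ n, ∃ p, T.label n = {p}

end RTree

/-- CTP^{¬,∨} node formulas, generated by p, ¬p, ⊤, ∧, ∨, ⟨↓⟩ and the strict
until U(·,·) (the translation target needs ∨; the bullet translation itself
only produces ∨-free formulas, i.e. CTP^¬ node formulas). -/
inductive CF (A : Type) : Type where
  | lab : A → CF A
  | nlab : A → CF A
  | top : CF A
  | and : CF A → CF A → CF A
  | or : CF A → CF A → CF A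
  | ex : CF A → CF A
  | untl : CF A → CF A → CF A

variable {A : Type}

/-- Satisfaction: `untl σ θ` is the strict until U(σ,θ) = ⟨(↓;?σ)*;↓⟩θ : some
strict descendant satisfies θ and every node strictly in between satisfies σ. -/
def CF.sat (T : RTree A) : CF A → Set T.Node
  | .lab p => {n | p ∈ T.label n}
  | .nlab p => {n | p ∉ T.label n}
  | .top => Set.univ
  | .and φ ψ => {n | n ∈ CF.sat T φ ∧ n ∈ CF.sat T ψ}
  | .or φ ψ => {n | n ∈ CF.sat T φ ∨ n ∈ CF.sat T ψ}
  | .ex φ => {n | ∃ m, T.E n m ∧ m ∈ CF.sat T φ}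
  | .untl σ θ => {n | ∃ m, Relation.TransGen T.E n m ∧ m ∈ CF.sat T θ ∧
      ∀ k, Relation.TransGen T.E n k → Relation.TransGen T.E k m →
        k ∈ CF.sat T σ}

/-- A formula is ∨-free, i.e. a CTP^¬ node formula. -/
def CF.orFree : CF A → Prop
  | .lab _ => True
  | .nlab _ => True
  | .top => True
  | .and φ ψ => CF.orFree φ ∧ CF.orFree ψ
  | .or _ _ => False
  | .ex φ => CF.orFree φ
  | .untl σ θ => CF.orFree σ ∧ CF.orFree θ

/-- Labels (positive or negated) occurring in a formula. -/
def CF.labs : CF A → Set A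
  | .lab p => {p}
  | .nlab p => {p}
  | .top => ∅
  | .and φ ψ => CF.labs φ ∪ CF.labs ψ
  | .or φ ψ => CF.labs φ ∪ CF.labs ψ
  | .ex φ => CF.labs φ
  | .untl σ θ => CF.labs σ ∪ CF.labs θ

/-- ⟨↓⁺⟩φ = U(⊤,φ). -/
def CF.diaPlus (φ : CF A) : CF A := .untl .top φ

/-- ⟨↓*⟩φ = φ ∨ ⟨↓⁺⟩φ. -/
def CF.diaStar (φ : CF A) : CF A := .or φ (CF.diaPlus φ)

/-- ζ = ⟨↓⟩(s ∧ ⋀_{i≤n}⟨↓⁺⟩pᵢ). -/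
def zeta (s : A) (ps : List A) : CF A :=
  .ex (.and (.lab s) ((ps.map fun p => CF.diaPlus (.lab p)).foldr .and .top))

/-- The translation (·)• encoding negated labels. -/
def bullet (s : A) (ps : List A) : CF A → CF A
  | .top => zeta s ps
  | .lab p => .and (zeta s ps) (.ex (.and (.lab s) (.ex (.lab p))))
  | .nlab p => .and (zeta s ps) (.ex (.and (.lab s) (.ex (CF.diaPlus (.lab p)))))
  | .and θ σ => .and (bullet s ps θ) (bullet s ps σ)
  | .or θ σ => .or (bullet s ps θ) (bullet s ps σ)
  | .ex θ => .and (zeta s ps) (.ex (bullet s ps θ))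
  | .untl θ σ => .and (zeta s ps) (.untl (bullet s ps θ) (bullet s ps σ))

/-- All ordered pairs (pᵢ, pⱼ) with i < j from a list. -/
def ltPairs : List A → List (A × A)
  | [] => []
  | a :: l => l.map (fun b => (a, b)) ++ ltPairs l

/-- Disjunct (1) of AX: ⟨↓*⟩(s ∧ ⟨↓*⟩ζ). -/
def ax1 (s : A) (ps : List A) : CF A :=
  CF.diaStar (.and (.lab s) (CF.diaStar (zeta s ps)))

/-- The disjuncts of (2): ⟨↓*⟩((pᵢ)• ∧ (¬pᵢ)•), i ≤ n. -/
def ax2 (s : A) (ps : List A) : List (CF A) :=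
  ps.map fun p => CF.diaStar (.and (bullet s ps (.lab p)) (bullet s ps (.nlab p)))

/-- The disjuncts of (3): ⟨↓*⟩((pᵢ)• ∧ (pⱼ)•), i ≠ j. -/
def ax3 (s : A) (ps : List A) : List (CF A) :=
  (ltPairs ps ++ (ltPairs ps).map Prod.swap).map fun pr =>
    CF.diaStar (.and (bullet s ps (.lab pr.1)) (bullet s ps (.lab pr.2)))

/-- AX = (1) ∨ (2) ∨ (3). -/
def AX (s : A) (ps : List A) : CF A :=
  (ax2 s ps ++ ax3 s ps).foldr .or (ax1 s ps)

/-- AX without the disjuncts (3), for the multi-labeled case. -/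
def AXml (s : A) (ps : List A) : CF A :=
  (ax2 s ps).foldr .or (ax1 s ps)

open Relation in
theorem sat_zeta (T : RTree A) (s : A) (ps : List A) (n : T.Node) :
    n ∈ CF.sat T (zeta s ps) ↔ ∃ m, T.E n m ∧ s ∈ T.label m ∧
      ∀ p ∈ ps, ∃ k, TransGen T.E m k ∧ p ∈ T.label k := by
  have key : ∀ (l : List A) (m : T.Node),
      m ∈ CF.sat T ((l.map fun p => CF.diaPlus (.lab p)).foldr .and .top) ↔
      ∀ p ∈ l, ∃ k, TransGen T.E m k ∧ p ∈ T.label k := by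
    intro l m
    induction l with
    | nil => simp [CF.sat]
    | cons a l ih =>
      rw [List.forall_mem_cons, ← ih]
      refine and_congr ?_ Iff.rfl
      exact ⟨fun ⟨k, h1, h2, _⟩ => ⟨k, h1, h2⟩, fun ⟨k, h1, h2⟩ => ⟨k, h1, h2, fun _ _ _ => trivial⟩⟩
  simp only [zeta, CF.sat, Set.mem_ofPred_eq, key]

open Relation in
theorem sat_diaStar (T : RTree A) (χ : CF A) (n : T.Node) :
    n ∈ CF.sat T (CF.diaStar χ) ↔ ∃ m, ReflTransGen T.E n m ∧ m ∈ CF.sat T χ := by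
  simp only [CF.diaStar, CF.diaPlus, CF.sat, Set.mem_ofPred_eq, Set.mem_univ, implies_true, and_true]
  constructor
  · rintro (h | ⟨m, h, h'⟩)
    · exact ⟨n, .refl, h⟩
    · exact ⟨m, h.to_reflTransGen, h'⟩
  · rintro ⟨m, h, h'⟩
    rcases (reflTransGen_iff_eq_or_transGen.1 h) with h | h
    · subst h; exact Or.inl h'
    · exact Or.inr ⟨m, h, h'⟩

theorem sat_foldr_or (T : RTree A) (l : List (CF A)) (b : CF A) (n : T.Node) :
    n ∈ CF.sat T (l.foldr .or b) ↔ n ∈ CF.sat T b ∨ ∃ χ ∈ l, n ∈ CF.sat T χ := by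
  induction l with
  | nil => simp
  | cons a l ih =>
    simp only [List.foldr_cons, CF.sat, Set.mem_ofPred_eq, ih, List.exists_mem_cons_iff]
    tauto

theorem bullet_zeta (T : RTree A) (s : A) (ps : List A) (χ : CF A) (n : T.Node)
    (h : n ∈ CF.sat T (bullet s ps χ)) : n ∈ CF.sat T (zeta s ps) := by
  induction χ with
  | top => exact h
  | lab p => exact h.1
  | nlab p => exact h.1
  | and a b iha ihb => exact iha h.1
  | or a b iha ihb => exact h.elim iha ihb
  | ex a ih => exact h.1
  | untl a b iha ihb => exact h.1

theorem ltPairs_ne (l : List A) (h : l.Nodup) (pr : A × A) (hp : pr ∈ ltPairs l) :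
    pr.1 ≠ pr.2 ∧ pr.1 ∈ l ∧ pr.2 ∈ l := by
  induction l with
  | nil => simp [ltPairs] at hp
  | cons a l ih =>
    rw [List.nodup_cons] at h
    simp only [ltPairs, List.mem_append, List.mem_map] at hp
    rcases hp with ⟨b, hb, rfl⟩ | hp
    · refine ⟨?_, by simp, by simp [hb]⟩
      intro he
      have he : a = b := he
      exact h.1 (he ▸ hb)
    · obtain ⟨h1, h2, h3⟩ := ih h.2 hp
      exact ⟨h1, List.mem_cons_of_mem _ h2, List.mem_cons_of_mem _ h3⟩

theorem mem_ltPairs (l : List A) (a b : A) (ha : a ∈ l) (hb : b ∈ l) (hab : a ≠ b) :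
    (a, b) ∈ ltPairs l ++ (ltPairs l).map Prod.swap := by
  have : (a, b) ∈ ltPairs l ∨ (b, a) ∈ ltPairs l := by
    induction l with
    | nil => simp at ha
    | cons c l ih =>
      simp only [ltPairs, List.mem_append, List.mem_map, List.mem_cons, Prod.mk.injEq] at *
      rcases ha with rfl | ha <;> rcases hb with rfl | hb
      · exact absurd rfl hab
      · exact Or.inl (Or.inl ⟨b, hb, rfl, rfl⟩)
      · exact Or.inr (Or.inl ⟨a, ha, rfl, rfl⟩)
      · rcases ih ha hb with h | h
        · exact Or.inl (Or.inr h)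
        · exact Or.inr (Or.inr h)
  simp only [List.mem_append, List.mem_map]
  rcases this with h | h
  · exact Or.inl h
  · exact Or.inr ⟨(b, a), h, rfl⟩

open Relation in
theorem core (T T' : RTree A) (s : A) (ps : List A) (f : T.Node → T'.Node)
    (hE : ∀ a b, T.E a b ↔ T'.E (f a) (f b))
    (hz : ∀ a, f a ∈ CF.sat T' (zeta s ps))
    (hch : ∀ a y, T'.E (f a) y → y ∈ CF.sat T' (zeta s ps) → ∃ c, f c = y)
    (hpar : ∀ a b y, TransGen T'.E (f a) y → T'.E y (f b) → ∃ c, f c = y)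
    (hpos : ∀ a, ∀ p ∈ ps, p ∈ T.label a ↔ f a ∈ CF.sat T' (bullet s ps (.lab p)))
    (hneg : ∀ a, ∀ p ∈ ps, p ∉ T.label a ↔ f a ∈ CF.sat T' (bullet s ps (.nlab p)))
    (χ : CF A) (hl : CF.labs χ ⊆ {a | a ∈ ps}) (a : T.Node) :
    a ∈ CF.sat T χ ↔ f a ∈ CF.sat T' (bullet s ps χ) := by
  have hconv : ∀ a b y, TransGen T'.E (f a) y → TransGen T'.E y (f b) → ∃ c, f c = y := by
    intro a b y h1 h2
    induction h2 using TransGen.head_induction_on with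
    | single h => exact hpar _ _ _ h1 h
    | head h h' ih =>
      obtain ⟨c, rfl⟩ := ih (h1.tail h)
      exact hpar _ _ _ h1 h
  have ht1 : ∀ a b, TransGen T.E a b → TransGen T'.E (f a) (f b) := fun a b h =>
    TransGen.lift f (fun x y hxy => (hE x y).1 hxy) _ _ h
  have ht2 : ∀ a b, TransGen T'.E (f a) (f b) → TransGen T.E a b := by
    intro a b h
    generalize hy : f b = y at h
    induction h generalizing b with
    | single h => subst hy; exact .single ((hE _ _).2 h)
    | tail h h' ih =>
      subst hy
      obtain ⟨c, rfl⟩ := hpar _ _ _ h h'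
      exact (ih c rfl).tail ((hE _ _).2 h')
  induction χ generalizing a with
  | top => exact ⟨fun _ => hz a, fun _ => trivial⟩
  | lab p => exact hpos a p (hl rfl)
  | nlab p => exact hneg a p (hl rfl)
  | and θ σ ih1 ih2 =>
    have h1 := ih1 (fun x hx => hl (Or.inl hx)) a
    have h2 := ih2 (fun x hx => hl (Or.inr hx)) a
    exact and_congr h1 h2
  | or θ σ ih1 ih2 =>
    have h1 := ih1 (fun x hx => hl (Or.inl hx)) a
    have h2 := ih2 (fun x hx => hl (Or.inr hx)) a
    exact or_congr h1 h2
  | ex θ ih =>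
    have ih := ih hl
    constructor
    · rintro ⟨m, h, h'⟩
      exact ⟨hz a, f m, (hE _ _).1 h, (ih m).1 h'⟩
    · rintro ⟨-, y, h, h'⟩
      obtain ⟨c, rfl⟩ := hch _ _ h (bullet_zeta _ _ _ _ _ h')
      exact ⟨c, (hE _ _).2 h, (ih c).2 h'⟩
  | untl θ σ ih1 ih2 =>
    have ih1 := ih1 (fun x hx => hl (Or.inl hx))
    have ih2 := ih2 (fun x hx => hl (Or.inr hx))
    constructor
    · rintro ⟨m, h, h', hk⟩
      refine ⟨hz a, f m, ht1 _ _ h, (ih2 m).1 h', ?_⟩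
      intro k hk1 hk2
      obtain ⟨c, rfl⟩ := hconv _ _ _ hk1 hk2
      exact (ih1 c).1 (hk c (ht2 _ _ hk1) (ht2 _ _ hk2))
    · rintro ⟨-, y, h, h', hk⟩
      have : ∃ c, f c = y := by
        have hzy := bullet_zeta _ _ _ _ _ h'
        have hk' : ∀ k, TransGen T'.E (f a) k → TransGen T'.E k y →
          k ∈ CF.sat T' (zeta s ps) := fun k h1 h2 => bullet_zeta _ _ _ _ _ (hk k h1 h2)
        clear hk h'
        induction h with
        | single h => exact hch _ _ h hzy
        | tail h h' ih =>
          obtain ⟨c, rfl⟩ := ih (hk' _ h (.single h')) (fun k h1 h2 => hk' k h1 (h2.tail h'))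
          exact hch _ _ h' hzy
      obtain ⟨c, rfl⟩ := this
      refine ⟨c, ht2 _ _ h, (ih2 c).2 h', fun k h1 h2 => ?_⟩
      exact (ih1 k).2 (hk _ (ht1 _ _ h1) (ht1 _ _ h2))

/- The component of `n` under nodes satisfying `zeta`. -/
open Relation in
def compT (T : RTree A) (Z : Set T.Node) (n : T.Node) (L : T.Node → Set A) : RTree A where
  Node := {m : T.Node // ReflTransGen (fun x y => T.E x y ∧ y ∈ Z) n m}
  E a b := T.E a.1 b.1
  root := ⟨n, .refl⟩
  label a := L a.1

open Relation in
theorem rtg_forget (T : RTree A) (Z : Set T.Node) (n m : T.Node)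
    (h : ReflTransGen (fun x y => T.E x y ∧ y ∈ Z) n m) : ReflTransGen T.E n m :=
  ReflTransGen.mono (fun _ _ h => h.1) _ _ h

open Relation in
theorem comp_par (T : RTree A) (hT : T.IsTree) (Z : Set T.Node) (n : T.Node)
    (y m : T.Node) (hm : ReflTransGen (fun x y => T.E x y ∧ y ∈ Z) n m)
    (hy : ReflTransGen T.E n y) (h : T.E y m) :
    ReflTransGen (fun x y => T.E x y ∧ y ∈ Z) n y ∧ m ∈ Z := by
  obtain ⟨⟨-, -, hu, hac⟩, -⟩ := hT
  cases hm with
  | refl => exact absurd (TransGen.tail' hy h) (hac _)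
  | tail h1 h2 =>
    have := hu _ _ _ h h2.1
    subst this
    exact ⟨h1, h2.2⟩

open Relation in
theorem comp_tree (T : RTree A) (hT : T.IsTree) (Z : Set T.Node) (n : T.Node)
    (L : T.Node → Set A) (hL : ∀ m, (L m).Finite) : (compT T Z n L).IsTree := by
  obtain ⟨⟨-, -, hu, hac⟩, hf⟩ := hT
  refine ⟨⟨fun m => hL m.1, ?_, ?_, ?_⟩, ?_⟩
  · rintro ⟨m, hm⟩
    induction hm with
    | refl => exact .refl
    | tail h1 h2 ih => exact ReflTransGen.tail ih h2.1
  · intro a b c h1 h2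
    exact Subtype.ext (hu _ _ _ h1 h2)
  · intro a h
    exact hac a.1 (TransGen.lift Subtype.val (fun _ _ h => h) _ _ h)
  · exact Finite.of_injective (fun x : (compT T Z n L).Node => x.1) Subtype.val_injective

open Relation in
theorem comp_core (T : RTree A) (hT : T.IsTree) (s : A) (ps : List A) (n : T.Node)
    (hn : n ∈ CF.sat T (zeta s ps)) (L : T.Node → Set A)
    (hLab : ∀ m, ∀ p ∈ ps, p ∈ L m ↔ m ∈ CF.sat T (bullet s ps (.lab p)))
    (hax2 : ∀ m, ReflTransGen T.E n m → ∀ p ∈ ps, m ∈ CF.sat T (bullet s ps (.lab p)) →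
      m ∈ CF.sat T (bullet s ps (.nlab p)) → False)
    (χ : CF A) (hl : CF.labs χ ⊆ {a | a ∈ ps}) :
    (⟨n, .refl⟩ : (compT T (CF.sat T (zeta s ps)) n L).Node) ∈
      CF.sat (compT T (CF.sat T (zeta s ps)) n L) χ ↔ n ∈ CF.sat T (bullet s ps χ) := by
  have hz : ∀ a : (compT T (CF.sat T (zeta s ps)) n L).Node, a.1 ∈ CF.sat T (zeta s ps) := by
    rintro ⟨m, hm⟩
    cases hm with
    | refl => exact hn
    | tail h1 h2 => exact h2.2
  refine core (compT T (CF.sat T (zeta s ps)) n L) T s ps Subtype.val (fun _ _ => Iff.rfl)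
    hz ?_ ?_ (fun a p hp => hLab a.1 p hp) ?_ χ hl ⟨n, .refl⟩
  · rintro ⟨m, hm⟩ y h1 h2
    exact ⟨⟨y, hm.tail ⟨h1, h2⟩⟩, rfl⟩
  · rintro ⟨m, hm⟩ ⟨b, hb⟩ y h1 h2
    exact ⟨⟨y, (comp_par T hT _ n y b hb
      ((rtg_forget _ _ _ _ hm).trans h1.to_reflTransGen) h2).1⟩, rfl⟩
  · intro a p hp
    have h0 := hLab a.1 p hp
    change p ∉ L a.1 ↔ _
    rw [h0]
    constructor
    · intro h
      refine ⟨hz a, ?_⟩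
      obtain ⟨m, h1, h2, h3⟩ := (sat_zeta _ _ _ _).1 (hz a)
      obtain ⟨k, hk, hpk⟩ := h3 p hp
      refine ⟨m, h1, h2, ?_⟩
      rcases TransGen.head'_iff.1 hk with ⟨c, hc, hck⟩
      rcases reflTransGen_iff_eq_or_transGen.1 hck with rfl | hck
      · exact absurd ⟨hz a, m, h1, h2, _, hc, hpk⟩ h
      · exact ⟨c, hc, k, hck, hpk, fun _ _ _ => trivial⟩
    · intro h h'
      exact hax2 a.1 (rtg_forget _ _ _ _ a.2) p hp h' h

/- The gadget tree. -/
inductive GN (N P : Type) : Type where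
  | orig : N → GN N P
  | sn : N → GN N P
  | mid : N → P → GN N P
  | leaf : N → P → GN N P

inductive GE (T : RTree A) (ps : List A) :
    GN T.Node {p // p ∈ ps} → GN T.Node {p // p ∈ ps} → Prop where
  | oo (a b) : T.E a b → GE T ps (.orig a) (.orig b)
  | os (a) : GE T ps (.orig a) (.sn a)
  | sm (a p) : GE T ps (.sn a) (.mid a p)
  | ml (a p) : p.1 ∉ T.label a → GE T ps (.mid a p) (.leaf a p)
  | sl (a p) : p.1 ∈ T.label a → GE T ps (.sn a) (.leaf a p)

def gT (T : RTree A) (ps : List A) (s q : A) : RTree A where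
  Node := GN T.Node {p // p ∈ ps}
  E := GE T ps
  root := .orig T.root
  label x := match x with
    | .orig _ => {q}
    | .sn _ => {s}
    | .mid _ _ => {q}
    | .leaf _ p => {p.1}

def GN.rk {N P : Type} : GN N P → ℕ
  | .orig _ => 0
  | .sn _ => 1
  | .mid _ _ => 2
  | .leaf _ _ => 3

theorem g_single (T : RTree A) (ps : List A) (s q : A) : (gT T ps s q).SingleLabeled := by
  rintro (a | a | ⟨a, p⟩ | ⟨a, p⟩)
  exacts [⟨q, rfl⟩, ⟨s, rfl⟩, ⟨q, rfl⟩, ⟨p.1, rfl⟩]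

open Relation in
theorem g_trans (T : RTree A) (ps : List A) (x y) (h : TransGen (GE T ps) x y) :
    (∃ a b, x = .orig a ∧ y = .orig b ∧ TransGen T.E a b) ∨ x.rk < y.rk := by
  induction h with
  | single h =>
    cases h with
    | oo a b h => exact Or.inl ⟨a, b, rfl, rfl, .single h⟩
    | _ => right; simp [GN.rk]
  | tail h h' ih =>
    rcases ih with ⟨a, b, rfl, rfl, ih⟩ | ih
    · cases h' with
      | oo _ c h => exact Or.inl ⟨a, c, rfl, rfl, ih.tail h⟩
      | os => right; simp [GN.rk]
    · right
      cases h' <;> simp [GN.rk] at * <;> omega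

open Relation in
theorem g_tree (T : RTree A) (hT : T.IsTree) (ps : List A) (s q : A) : (gT T ps s q).IsTree := by
  obtain ⟨⟨-, hc, hu, hac⟩, hf⟩ := hT
  refine ⟨⟨?_, ?_, ?_, ?_⟩, ?_⟩
  · intro n
    obtain ⟨p, hp⟩ := g_single T ps s q n
    rw [hp]
    exact Set.finite_singleton p
  · have ho : ∀ a, ReflTransGen (GE T ps) (.orig T.root) (.orig a) := fun a =>
      ReflTransGen.lift GN.orig (fun x y h => GE.oo x y h) _ _ (hc a)
    have hsn : ∀ a, ReflTransGen (GE T ps) (.orig T.root) (.sn a) := fun a =>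
      (ho a).tail (.os a)
    have hm : ∀ a p, ReflTransGen (GE T ps) (.orig T.root) (.mid a p) := fun a p =>
      (hsn a).tail (.sm a p)
    rintro (a | a | ⟨a, p⟩ | ⟨a, p⟩)
    · exact ho a
    · exact hsn a
    · exact hm a p
    · by_cases h : p.1 ∈ T.label a
      · exact (hsn a).tail (.sl a p h)
      · exact (hm a p).tail (.ml a p h)
  · intro n m m' h1 h2
    change GE T ps m n at h1
    change GE T ps m' n at h2
    cases h1 <;> cases h2 <;> first | rfl | contradiction | skip
    rename_i b h c h'
    rw [hu _ _ _ h h']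
  · intro n h
    rcases g_trans T ps n n h with ⟨a, b, rfl, hb, h⟩ | h
    · cases hb
      exact hac _ h
    · exact absurd h (lt_irrefl _)
  · have : Function.Surjective (fun x : (T.Node ⊕ T.Node) ⊕
        ((T.Node × {p // p ∈ ps}) ⊕ (T.Node × {p // p ∈ ps})) => match x with
      | .inl (.inl a) => (GN.orig a : GN T.Node {p // p ∈ ps})
      | .inl (.inr a) => .sn a
      | .inr (.inl a) => .mid a.1 a.2
      | .inr (.inr a) => .leaf a.1 a.2) := by
      rintro (a | a | ⟨a, p⟩ | ⟨a, p⟩)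
      exacts [⟨.inl (.inl a), rfl⟩, ⟨.inl (.inr a), rfl⟩, ⟨.inr (.inl (a, p)), rfl⟩,
        ⟨.inr (.inr (a, p)), rfl⟩]
    have hfp : Finite {p // p ∈ ps} := List.finite_toSet ps
    exact Finite.of_surjective _ this

section gadget
open Relation
variable (T : RTree A) (ps : List A) (s q : A) (hs : s ∉ ps) (hq : q ∉ ps) (hqs : q ≠ s)
include hs hq hqs

theorem g_s (x : (gT T ps s q).Node) (h : s ∈ (gT T ps s q).label x) : ∃ a, x = GN.sn a := by
  rcases x with (a | a | ⟨a, p⟩ | ⟨a, p⟩)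
  · exact absurd h.symm hqs
  · exact ⟨a, rfl⟩
  · exact absurd h.symm hqs
  · have h : s = p.1 := h
    exact absurd p.2 (h ▸ hs)

theorem g_p (p : A) (hp : p ∈ ps) (x : (gT T ps s q).Node) (h : p ∈ (gT T ps s q).label x) :
    ∃ a, x = GN.leaf a ⟨p, hp⟩ := by
  rcases x with (a | a | ⟨a, p'⟩ | ⟨a, p'⟩)
  · have h : p = q := h
    exact absurd hp (h ▸ hq)
  · have h : p = s := h
    exact absurd hp (h ▸ hs)
  · have h : p = q := h
    exact absurd hp (h ▸ hq)
  · have h : p = p'.1 := h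
    subst h
    exact ⟨a, rfl⟩

theorem g_zeta (x : (gT T ps s q).Node) (h : x ∈ CF.sat (gT T ps s q) (zeta s ps)) :
    ∃ a, GN.orig a = x := by
  obtain ⟨m, h1, h2, -⟩ := (sat_zeta _ _ _ _).1 h
  obtain ⟨a, rfl⟩ := g_s T ps s q hs hq hqs m h2
  have h1 : GE T ps x (.sn a) := h1
  cases h1
  exact ⟨_, rfl⟩

theorem g_zeta_orig (a : T.Node) :
    (GN.orig a : (gT T ps s q).Node) ∈ CF.sat (gT T ps s q) (zeta s ps) := by
  refine (sat_zeta _ _ _ _).2 ⟨GN.sn a, GE.os a, rfl, fun p hp => ⟨GN.leaf a ⟨p, hp⟩, ?_, rfl⟩⟩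
  by_cases h : p ∈ T.label a
  · exact TransGen.single (GE.sl a ⟨p, hp⟩ h)
  · exact TransGen.tail (TransGen.single (GE.sm a ⟨p, hp⟩)) (GE.ml a ⟨p, hp⟩ h)

theorem g_pos (a : T.Node) (p : A) (hp : p ∈ ps) : p ∈ T.label a ↔
    (GN.orig a : (gT T ps s q).Node) ∈ CF.sat (gT T ps s q) (bullet s ps (.lab p)) := by
  constructor
  · intro h
    exact ⟨g_zeta_orig T ps s q hs hq hqs a, GN.sn a, GE.os a, rfl, GN.leaf a ⟨p, hp⟩,
      GE.sl a ⟨p, hp⟩ h, rfl⟩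
  · rintro ⟨-, m, h1, h2, k, h3, h4⟩
    obtain ⟨b, rfl⟩ := g_s T ps s q hs hq hqs m h2
    obtain ⟨c, rfl⟩ := g_p T ps s q hs hq hqs p hp k h4
    have h1 : GE T ps (.orig a) (.sn b) := h1
    have h3 : GE T ps (.sn b) (.leaf c ⟨p, hp⟩) := h3
    cases h1
    cases h3
    assumption

theorem g_neg (a : T.Node) (p : A) (hp : p ∈ ps) : p ∉ T.label a ↔
    (GN.orig a : (gT T ps s q).Node) ∈ CF.sat (gT T ps s q) (bullet s ps (.nlab p)) := by
  constructor
  · intro h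
    exact ⟨g_zeta_orig T ps s q hs hq hqs a, GN.sn a, GE.os a, rfl, GN.mid a ⟨p, hp⟩,
      GE.sm a ⟨p, hp⟩, GN.leaf a ⟨p, hp⟩, TransGen.single (GE.ml a ⟨p, hp⟩ h), rfl,
      fun _ _ _ => trivial⟩
  · rintro ⟨-, m, h1, h2, k, h3, l, h4, h5, -⟩
    obtain ⟨b, rfl⟩ := g_s T ps s q hs hq hqs m h2
    obtain ⟨c, rfl⟩ := g_p T ps s q hs hq hqs p hp l h5
    have h1 : GE T ps (.orig a) (.sn b) := h1
    have h3 : GE T ps (.sn b) k := h3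
    have h4 : TransGen (GE T ps) k (.leaf c ⟨p, hp⟩) := h4
    cases h1
    rcases TransGen.tail'_iff.1 h4 with ⟨d, hd, hd'⟩
    have hkd := reflTransGen_iff_eq_or_transGen.1 hd
    have hk : 2 ≤ k.rk := by cases h3 <;> simp [GN.rk]
    have hd2 : 2 ≤ d.rk := by
      rcases hkd with rfl | hkd
      · exact hk
      · rcases g_trans _ _ _ _ hkd with ⟨a, b, rfl, -, -⟩ | h
        · simp [GN.rk] at hk
        · omega
    cases hd' with
    | sl => simp [GN.rk] at hd2
    | ml _ _ hh =>
      rcases hkd with hkd | hkd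
      · subst hkd
        cases h3
        exact hh
      · rcases g_trans _ _ _ _ hkd with ⟨a, b, rfl, -, -⟩ | h
        · simp [GN.rk] at hk
        · simp only [GN.rk] at h hk
          omega

theorem g_core (χ : CF A) (hl : CF.labs χ ⊆ {a | a ∈ ps}) (a : T.Node) :
    a ∈ CF.sat T χ ↔
      (GN.orig a : (gT T ps s q).Node) ∈ CF.sat (gT T ps s q) (bullet s ps χ) := by
  refine core T (gT T ps s q) s ps GN.orig ?_ (g_zeta_orig T ps s q hs hq hqs) ?_ ?_
    (g_pos T ps s q hs hq hqs) (g_neg T ps s q hs hq hqs) χ hl a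
  · intro a b
    constructor
    · exact fun h => GE.oo a b h
    · intro h
      have h : GE T ps (.orig a) (.orig b) := h
      cases h
      assumption
  · intro a y _ h
    exact g_zeta T ps s q hs hq hqs y h
  · intro a b y _ h
    have h : GE T ps y (.orig b) := h
    cases h
    exact ⟨_, rfl⟩

theorem g_ax1 (x : (gT T ps s q).Node) : x ∉ CF.sat (gT T ps s q) (ax1 s ps) := by
  intro h
  obtain ⟨m, -, h1, h2⟩ := (sat_diaStar _ _ _).1 h
  obtain ⟨k, h3, h4⟩ := (sat_diaStar _ _ _).1 h2
  obtain ⟨a, rfl⟩ := g_s T ps s q hs hq hqs m h1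
  obtain ⟨b, rfl⟩ := g_zeta T ps s q hs hq hqs k h4
  rcases reflTransGen_iff_eq_or_transGen.1 h3 with h | h
  · cases h
  · rcases g_trans _ _ _ _ h with ⟨a, b, h, -, -⟩ | h
    · cases h
    · simp [GN.rk] at h

theorem g_ax2 (x : (gT T ps s q).Node) (χ) (hχ : χ ∈ ax2 s ps) :
    x ∉ CF.sat (gT T ps s q) χ := by
  intro h
  obtain ⟨p, hp, rfl⟩ := List.mem_map.1 hχ
  obtain ⟨m, -, h1, h2⟩ := (sat_diaStar _ _ _).1 h
  obtain ⟨a, rfl⟩ := g_zeta T ps s q hs hq hqs m (bullet_zeta _ _ _ _ _ h1)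
  exact (g_neg T ps s q hs hq hqs a p hp).2 h2 ((g_pos T ps s q hs hq hqs a p hp).2 h1)

theorem g_ax3 (hT : T.SingleLabeled) (hnd : ps.Nodup) (x : (gT T ps s q).Node) (χ)
    (hχ : χ ∈ ax3 s ps) : x ∉ CF.sat (gT T ps s q) χ := by
  intro h
  obtain ⟨⟨p, r⟩, hp, rfl⟩ := List.mem_map.1 hχ
  have hpr : p ≠ r ∧ p ∈ ps ∧ r ∈ ps := by
    rcases List.mem_append.1 hp with hp | hp
    · exact ltPairs_ne ps hnd _ hp
    · obtain ⟨⟨u, v⟩, hp', he⟩ := List.mem_map.1 hp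
      cases he
      obtain ⟨h1, h2, h3⟩ := ltPairs_ne ps hnd _ hp'
      exact ⟨h1.symm, h3, h2⟩
  obtain ⟨m, -, h1, h2⟩ := (sat_diaStar _ _ _).1 h
  obtain ⟨a, rfl⟩ := g_zeta T ps s q hs hq hqs m (bullet_zeta _ _ _ _ _ h1)
  have e1 := (g_pos T ps s q hs hq hqs a p hpr.2.1).2 h1
  have e2 := (g_pos T ps s q hs hq hqs a r hpr.2.2).2 h2
  obtain ⟨t, ht⟩ := hT a
  rw [ht] at e1 e2
  exact hpr.1 (e1.trans e2.symm)

end gadget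

/-- encoding of negated labels into CTP: for CTP^¬ node formulas
φ and ψ whose (negated) labels are among p₁,…,p_n, and a fresh label s:
(a) φ ⊆ ψ over single-labeled trees iff φ• ⊆ ψ•∨AX over single-labeled trees;
(b) φ ⊆ ψ over multi-labeled trees iff φ• ⊆ ψ•∨(1)∨(2) over multi-labeled
trees. -/
theorem ctp_neg_encoding [Infinite A] (ps : List A) (hnd : ps.Nodup)
    (s : A) (hs : s ∉ ps) (φ ψ : CF A)
    (hφo : CF.orFree φ) (hψo : CF.orFree ψ)
    (hφ : CF.labs φ ⊆ {a | a ∈ ps}) (hψ : CF.labs ψ ⊆ {a | a ∈ ps}) :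
    ((∀ T : RTree A, T.IsTree → T.SingleLabeled →
        ∀ n : T.Node, n ∈ CF.sat T φ → n ∈ CF.sat T ψ) ↔
      (∀ T : RTree A, T.IsTree → T.SingleLabeled →
        ∀ n : T.Node, n ∈ CF.sat T (bullet s ps φ) →
          n ∈ CF.sat T (.or (bullet s ps ψ) (AX s ps)))) ∧
    ((∀ T : RTree A, T.IsTree →
        ∀ n : T.Node, n ∈ CF.sat T φ → n ∈ CF.sat T ψ) ↔
      (∀ T : RTree A, T.IsTree →
        ∀ n : T.Node, n ∈ CF.sat T (bullet s ps φ) →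
          n ∈ CF.sat T (.or (bullet s ps ψ) (AXml s ps)))) := by
  classical
  obtain ⟨q, hq'⟩ := Infinite.exists_notMem_finset (insert s ps.toFinset)
  have hqs : q ≠ s := fun h => hq' (by simp [h])
  have hq : q ∉ ps := fun h => hq' (by simp [h])
  have hn2 : ∀ (T : RTree A) (n : T.Node), (∀ χ ∈ ax2 s ps, n ∉ CF.sat T χ) →
      ∀ m, Relation.ReflTransGen T.E n m → ∀ p ∈ ps, m ∈ CF.sat T (bullet s ps (.lab p)) →
      m ∈ CF.sat T (bullet s ps (.nlab p)) → False := by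
    intro T n h m hm p hp h1 h2
    exact h _ (List.mem_map.2 ⟨p, hp, rfl⟩) ((sat_diaStar _ _ _).2 ⟨m, hm, h1, h2⟩)
  refine ⟨⟨?_, ?_⟩, ⟨?_, ?_⟩⟩
  · intro H T hT _ n hn
    by_contra hcon
    have hc1 : n ∉ CF.sat T (bullet s ps ψ) := fun h => hcon (Or.inl h)
    have hc2 : n ∉ CF.sat T (AX s ps) := fun h => hcon (Or.inr h)
    rw [AX, sat_foldr_or] at hc2
    have hz := bullet_zeta _ _ _ _ _ hn
    have hax2 := hn2 T n (fun χ hχ h => hc2 (Or.inr ⟨χ, List.mem_append_left _ hχ, h⟩))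
    have hax3 : ∀ m, Relation.ReflTransGen T.E n m → ∀ p ∈ ps, ∀ r ∈ ps,
        m ∈ CF.sat T (bullet s ps (.lab p)) → m ∈ CF.sat T (bullet s ps (.lab r)) → p = r := by
      intro m hm p hp r hr h1 h2
      by_contra hpr
      exact hc2 (Or.inr ⟨_, List.mem_append_right _
        (List.mem_map.2 ⟨(p, r), mem_ltPairs ps p r hp hr hpr, rfl⟩),
        (sat_diaStar _ _ _).2 ⟨m, hm, h1, h2⟩⟩)
    let L : T.Node → Set A := fun m =>
      if (∃ p ∈ ps, m ∈ CF.sat T (bullet s ps (.lab p))) then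
        {p | p ∈ ps ∧ m ∈ CF.sat T (bullet s ps (.lab p))} else {q}
    have hLfin : ∀ m, (L m).Finite := by
      intro m
      simp only [L]
      split_ifs
      · exact (List.finite_toSet ps).subset (fun x hx => hx.1)
      · exact Set.finite_singleton q
    have hLab : ∀ m, ∀ p ∈ ps, p ∈ L m ↔ m ∈ CF.sat T (bullet s ps (.lab p)) := by
      intro m p hp
      simp only [L]
      split_ifs with h
      · exact ⟨fun h => h.2, fun h => ⟨hp, h⟩⟩
      · refine ⟨fun h' => ?_, fun h' => absurd ⟨p, hp, h'⟩ h⟩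
        have h' : p = q := h'
        exact absurd hp (h' ▸ hq)
    have hsl : (compT T (CF.sat T (zeta s ps)) n L).SingleLabeled := by
      rintro ⟨m, hm⟩
      change ∃ p, L m = {p}
      simp only [L]
      split_ifs with h
      · obtain ⟨p, hp, h⟩ := h
        refine ⟨p, Set.ext fun r => ⟨fun hr => ?_, fun hr => ?_⟩⟩
        · exact hax3 m (rtg_forget _ _ _ _ hm) r hr.1 p hp hr.2 h
        · have hr : r = p := hr
          subst hr
          exact ⟨hp, h⟩
      · exact ⟨q, rfl⟩
    have := H _ (comp_tree T hT (CF.sat T (zeta s ps)) n L hLfin) hsl ⟨n, .refl⟩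
      ((comp_core T hT s ps n hz L hLab hax2 φ hφ).2 hn)
    exact hc1 ((comp_core T hT s ps n hz L hLab hax2 ψ hψ).1 this)
  · intro H T hT hsl n hn
    rcases H (gT T ps s q) (g_tree T hT ps s q) (g_single T ps s q) (GN.orig n)
      ((g_core T ps s q hs hq hqs φ hφ n).1 hn) with h | h
    · exact (g_core T ps s q hs hq hqs ψ hψ n).2 h
    · replace h := (sat_foldr_or _ _ _ _).1 h
      rcases h with h | ⟨χ, hχ, h⟩
      · exact absurd h (g_ax1 T ps s q hs hq hqs _)
      · rcases List.mem_append.1 hχ with hχ | hχ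
        · exact absurd h (g_ax2 T ps s q hs hq hqs _ χ hχ)
        · exact absurd h (g_ax3 T ps s q hs hq hqs hsl hnd _ χ hχ)
  · intro H T hT n hn
    by_contra hcon
    have hc1 : n ∉ CF.sat T (bullet s ps ψ) := fun h => hcon (Or.inl h)
    have hc2 : n ∉ CF.sat T (AXml s ps) := fun h => hcon (Or.inr h)
    rw [AXml, sat_foldr_or] at hc2
    have hz := bullet_zeta _ _ _ _ _ hn
    have hax2 := hn2 T n (fun χ hχ h => hc2 (Or.inr ⟨χ, hχ, h⟩))
    let L : T.Node → Set A := fun m => {p | p ∈ ps ∧ m ∈ CF.sat T (bullet s ps (.lab p))}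
    have hLfin : ∀ m, (L m).Finite := fun m =>
      (List.finite_toSet ps).subset (fun x hx => hx.1)
    have hLab : ∀ m, ∀ p ∈ ps, p ∈ L m ↔ m ∈ CF.sat T (bullet s ps (.lab p)) :=
      fun m p hp => ⟨fun h => h.2, fun h => ⟨hp, h⟩⟩
    have := H _ (comp_tree T hT (CF.sat T (zeta s ps)) n L hLfin) ⟨n, .refl⟩
      ((comp_core T hT s ps n hz L hLab hax2 φ hφ).2 hn)
    exact hc1 ((comp_core T hT s ps n hz L hLab hax2 ψ hψ).1 this)
  · intro H T hT n hn
    rcases H (gT T ps s q) (g_tree T hT ps s q) (GN.orig n)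
      ((g_core T ps s q hs hq hqs φ hφ n).1 hn) with h | h
    · exact (g_core T ps s q hs hq hqs ψ hψ n).2 h
    · replace h := (sat_foldr_or _ _ _ _).1 h
      rcases h with h | ⟨χ, hχ, h⟩
      · exact absurd h (g_ax1 T ps s q hs hq hqs _)
      · exact absurd h (g_ax2 T ps s q hs hq hqs _ χ hχ)
end

section
/- Reduction of CTP^{¬,∨} containment to containment over infinite trees: let φ and ψ be CTP^{¬,∨} node formulas and s a label not occurring in φ or ψ. Define the translation (·)^s into existential CTL node formulas by: ⊤^s = s∧⊤; p^s = s∧p; (¬p)^s = s∧¬p; (θ∧σ)^s = θ^s∧σ^s; (θ∨σ)^s = θ^s∨σ^s; (⟨↓⟩θ)^s = s∧∃Xθ^s; (U(σ,θ))^s = s∧∃X∃(σ^s U θ^s). Then φ is contained in ψ over finite multi-labeled trees if and only if φ^s is contained in ψ^s over infinite finitely branching multi-labeled trees (i.e., for every infinite finitely branching tree T and node n, T,n⊨φ^s implies T,n⊨ψ^s). -/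
variable {A : Type}

/-- Existential CTL node formulas used as the target of the translation:
`exX θ` is ∃Xθ, and `exU σ θ` is ∃(σ U θ) (non-strict until). -/
inductive EC (A : Type) : Type where
  | lab : A → EC A
  | nlab : A → EC A
  | top : EC A
  | and : EC A → EC A → EC A
  | or : EC A → EC A → EC A
  | exX : EC A → EC A
  | exU : EC A → EC A → EC A

/-- Satisfaction of ECTL node formulas on trees. -/
def EC.sat (T : RTree A) : EC A → Set T.Node
  | .lab p => {n | p ∈ T.label n}
  | .nlab p => {n | p ∉ T.label n}
  | .top => Set.univ
  | .and φ ψ => {n | n ∈ EC.sat T φ ∧ n ∈ EC.sat T ψ}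
  | .or φ ψ => {n | n ∈ EC.sat T φ ∨ n ∈ EC.sat T ψ}
  | .exX φ => {n | ∃ m, T.E n m ∧ m ∈ EC.sat T φ}
  | .exU σ θ => {n | ∃ m, Relation.ReflTransGen T.E n m ∧ m ∈ EC.sat T θ ∧
      ∀ k, Relation.ReflTransGen T.E n k → Relation.TransGen T.E k m →
        k ∈ EC.sat T σ}

/-- The relativizing translation (·)^s from CTP^{¬,∨} node formulas into
existential CTL. -/
def trs (s : A) : CF A → EC A
  | .top => .and (.lab s) .top
  | .lab p => .and (.lab s) (.lab p)
  | .nlab p => .and (.lab s) (.nlab p)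
  | .and θ σ => .and (trs s θ) (trs s σ)
  | .or θ σ => .or (trs s θ) (trs s σ)
  | .ex θ => .and (.lab s) (.exX (trs s θ))
  | .untl σ θ => .and (.lab s) (.exX (.exU (trs s σ) (trs s θ)))

/-- Infinite finitely branching trees: every node has finitely many children
and every branch is infinite (every node has a child); label sets are finite,
the tree is connected from the root, parents are unique and there are no
cycles. -/
def RTree.IsInfTree (T : RTree A) : Prop :=
  T.IsPreTree ∧ (∀ n, ∃ m, T.E n m) ∧ (∀ n : T.Node, {m | T.E n m}.Finite)

namespace CtpAux
open Relation

/-- Induced substructure. -/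
def sub (T : RTree A) (S : Set T.Node) (n : S) : RTree A where
  Node := S
  E := fun a b => T.E a.1 b.1
  root := n
  label := fun a => T.label a.1

def Convex (T : RTree A) (S : Set T.Node) : Prop :=
  ∀ a b c, a ∈ S → b ∈ S → ReflTransGen T.E a c → ReflTransGen T.E c b → c ∈ S

theorem sub_trans {T : RTree A} {S : Set T.Node} (hS : Convex T S) (n : S) (a b : S) :
    TransGen (sub T S n).E a b ↔ TransGen T.E a.1 b.1 := by
  constructor
  · intro h
    exact TransGen.lift (r := (sub T S n).E) (p := T.E) (fun x : S => x.1) (fun _ _ h => h) _ _ h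
  · obtain ⟨b, hb⟩ := b
    intro h
    simp only at h
    induction h with
    | single h => exact TransGen.single h
    | tail h1 h2 ih =>
      rename_i c d
      have hc : c ∈ S := hS a.1 d c a.2 hb h1.to_reflTransGen (ReflTransGen.single h2)
      exact TransGen.tail (ih hc) h2

theorem sub_refl {T : RTree A} {S : Set T.Node} (hS : Convex T S) (n : S) (a b : S)
    (h : ReflTransGen T.E a.1 b.1) : ReflTransGen (sub T S n).E a b := by
  rcases reflTransGen_iff_eq_or_transGen.1 h with h | h
  · have : b = a := Subtype.ext h
    subst this; exact ReflTransGen.refl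
  · exact ((sub_trans hS n a b).2 h).to_reflTransGen

theorem sub_isTree {T : RTree A} (hT : T.IsPreTree) {S : Set T.Node} (hS : Convex T S)
    (hf : S.Finite) (n : S) (hn : ∀ a ∈ S, ReflTransGen T.E n.1 a) : (sub T S n).IsTree := by
  refine ⟨⟨fun a => hT.1 a.1, fun a => sub_refl hS n n a (hn a.1 a.2), ?_, ?_⟩, hf.to_subtype⟩
  · intro a b c h1 h2
    exact Subtype.ext (hT.2.2.1 _ _ _ h1 h2)
  · intro a h
    exact hT.2.2.2 _ ((sub_trans hS n a a).1 h)

theorem trs_lab (T : RTree A) (s : A) (θ : CF A) (m : T.Node)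
    (h : m ∈ EC.sat T (trs s θ)) : s ∈ T.label m := by
  induction θ with
  | and a b iha ihb => exact iha h.1
  | or a b iha ihb => exact h.elim iha ihb
  | _ => exact h.1

theorem up {T : RTree A} {S : Set T.Node} (hS : Convex T S) (n : S) (s : A)
    (hs : ∀ a ∈ S, s ∈ T.label a) (θ : CF A) (m : S)
    (h : m ∈ CF.sat (sub T S n) θ) : m.1 ∈ EC.sat T (trs s θ) := by
  induction θ generalizing m with
  | lab p => exact ⟨hs _ m.2, h⟩
  | nlab p => exact ⟨hs _ m.2, h⟩
  | top => exact ⟨hs _ m.2, trivial⟩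
  | and a b iha ihb => exact ⟨iha m h.1, ihb m h.2⟩
  | or a b iha ihb => exact h.elim (fun h => Or.inl (iha m h)) (fun h => Or.inr (ihb m h))
  | ex a ih =>
    obtain ⟨k, h1, h2⟩ := h
    exact ⟨hs _ m.2, k.1, h1, ih k h2⟩
  | untl a b iha ihb =>
    obtain ⟨k, h1, h2, h3⟩ := h
    have h1' := (sub_trans hS n m k).1 h1
    obtain ⟨c, hc1, hc2⟩ := TransGen.head'_iff.1 h1'
    refine ⟨hs _ m.2, c, hc1, k.1, hc2, ihb k h2, ?_⟩
    intro j hj1 hj2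
    have hmj : TransGen T.E m.1 j := TransGen.head' hc1 hj1
    have hj : j ∈ S := hS m.1 k.1 j m.2 k.2 hmj.to_reflTransGen hj2.to_reflTransGen
    exact iha ⟨j, hj⟩ (h3 ⟨j, hj⟩ ((sub_trans hS n m ⟨j, hj⟩).2 hmj)
      ((sub_trans hS n ⟨j, hj⟩ k).2 hj2))

theorem anc_finite {T : RTree A} (hT : T.IsPreTree) (m : T.Node) :
    {k | ReflTransGen T.E k m}.Finite := by
  have h := hT.2.1 m
  induction h with
  | refl =>
    refine (Set.finite_singleton T.root).subset ?_
    intro k hk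
    rcases reflTransGen_iff_eq_or_transGen.1 hk with h | h
    · exact h.symm
    · exact (hT.2.2.2 _ (TransGen.trans_right (hT.2.1 k) h)).elim
  | tail h1 h2 ih =>
    rename_i b c
    refine (ih.union (Set.finite_singleton c)).subset ?_
    intro k hk
    rcases ReflTransGen.cases_tail hk with h | ⟨d, h3, h4⟩
    · exact Or.inr h.symm
    · left
      have := hT.2.2.1 _ _ _ h2 h4
      subst this; exact h3

theorem comparable {T : RTree A} (hT : T.IsPreTree) {a b f : T.Node}
    (ha : ReflTransGen T.E a f) (hb : ReflTransGen T.E b f) :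
    ReflTransGen T.E a b ∨ ReflTransGen T.E b a := by
  induction ha with
  | refl => exact Or.inr hb
  | tail h1 h2 ih =>
    rcases ReflTransGen.cases_tail hb with h | ⟨d, h3, h4⟩
    · subst h; exact Or.inl (h1.tail h2)
    · have := hT.2.2.1 _ _ _ h2 h4
      subst this; exact ih h3

/-- Finite prefix-closed sets of s-nodes below m. -/
def Good (T : RTree A) (s : A) (m : T.Node) (F : Set T.Node) : Prop :=
  F.Finite ∧ m ∈ F ∧ (∀ f ∈ F, s ∈ T.label f ∧ ReflTransGen T.E m f ∧
    ∀ k, ReflTransGen T.E m k → ReflTransGen T.E k f → k ∈ F)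

theorem Good.convex {T : RTree A} {s : A} {m : T.Node} {F : Set T.Node} (h : Good T s m F) :
    Convex T F := by
  intro a b c ha hb hac hcb
  exact (h.2.2 b hb).2.2 c ((h.2.2 a ha).2.1.trans hac) hcb

theorem Good.singleton {T : RTree A} (hT : T.IsPreTree) {s : A} {m : T.Node}
    (hs : s ∈ T.label m) : Good T s m {m} := by
  refine ⟨Set.finite_singleton _, rfl, ?_⟩
  rintro f rfl
  refine ⟨hs, ReflTransGen.refl, fun k h1 h2 => ?_⟩
  rcases reflTransGen_iff_eq_or_transGen.1 h1 with h | h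
  · exact h
  · exact (hT.2.2.2 _ (h.trans_left h2)).elim

theorem Good.union {T : RTree A} {s : A} {m : T.Node} {F G : Set T.Node}
    (hF : Good T s m F) (hG : Good T s m G) : Good T s m (F ∪ G) := by
  refine ⟨hF.1.union hG.1, Or.inl hF.2.1, ?_⟩
  rintro f (hf | hf)
  · obtain ⟨h1, h2, h3⟩ := hF.2.2 f hf
    exact ⟨h1, h2, fun k a b => Or.inl (h3 k a b)⟩
  · obtain ⟨h1, h2, h3⟩ := hG.2.2 f hf
    exact ⟨h1, h2, fun k a b => Or.inr (h3 k a b)⟩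

/-- Glue good sets along a path from m to e. -/
theorem Good.path {T : RTree A} (hT : T.IsPreTree) {s : A} {m e : T.Node}
    (hme : ReflTransGen T.E m e) (F : T.Node → Set T.Node)
    (hF : ∀ k, ReflTransGen T.E m k → ReflTransGen T.E k e → Good T s k (F k)) :
    Good T s m (⋃ k ∈ {k | ReflTransGen T.E m k ∧ ReflTransGen T.E k e}, F k) := by
  refine ⟨?_, ?_, ?_⟩
  · refine Set.Finite.biUnion ((anc_finite hT e).subset fun k hk => hk.2) ?_
    intro k hk
    exact (hF k hk.1 hk.2).1
  · exact Set.mem_biUnion (show m ∈ {k | _ ∧ _} from ⟨ReflTransGen.refl, hme⟩)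
      (hF m ReflTransGen.refl hme).2.1
  · intro f hf
    obtain ⟨k, ⟨hk1, hk2⟩, hfk⟩ := Set.mem_iUnion₂.1 hf
    obtain ⟨h1, h2, h3⟩ := (hF k hk1 hk2).2.2 f hfk
    refine ⟨h1, hk1.trans h2, fun j hj1 hj2 => ?_⟩
    rcases comparable hT hj2 h2 with h | h
    · exact Set.mem_biUnion (show j ∈ {k | _ ∧ _} from ⟨hj1, h.trans hk2⟩)
        (hF j hj1 (h.trans hk2)).2.1
    · exact Set.mem_biUnion (show k ∈ {k | _ ∧ _} from ⟨hk1, hk2⟩) (h3 j h hj2)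

theorem down {T : RTree A} (hT : T.IsPreTree) (s : A) (θ : CF A) (m : T.Node)
    (h : m ∈ EC.sat T (trs s θ)) : ∃ F, Good T s m F ∧ ∀ S, Convex T S → F ⊆ S → ∀ n : S,
      ∀ hm : m ∈ S, (⟨m, hm⟩ : S) ∈ CF.sat (sub T S n) θ := by
  have hs := trs_lab T s θ m h
  induction θ generalizing m with
  | lab p => exact ⟨{m}, Good.singleton hT hs, fun S _ _ n hm => h.2⟩
  | nlab p => exact ⟨{m}, Good.singleton hT hs, fun S _ _ n hm => h.2⟩
  | top => exact ⟨{m}, Good.singleton hT hs, fun S _ _ n hm => trivial⟩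
  | and a b iha ihb =>
    obtain ⟨F, hF, hF'⟩ := iha m h.1 hs
    obtain ⟨G, hG, hG'⟩ := ihb m h.2 hs
    exact ⟨F ∪ G, hF.union hG, fun S hS hFS n hm =>
      ⟨hF' S hS (Set.subset_union_left.trans hFS) n hm,
       hG' S hS (Set.subset_union_right.trans hFS) n hm⟩⟩
  | or a b iha ihb =>
    rcases h with h | h
    · obtain ⟨F, hF, hF'⟩ := iha m h hs
      exact ⟨F, hF, fun S hS hFS n hm => Or.inl (hF' S hS hFS n hm)⟩
    · obtain ⟨F, hF, hF'⟩ := ihb m h hs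
      exact ⟨F, hF, fun S hS hFS n hm => Or.inr (hF' S hS hFS n hm)⟩
  | ex a ih =>
    obtain ⟨-, k, hmk, hk⟩ := h
    obtain ⟨F, hF, hF'⟩ := ih k hk (trs_lab T s a k hk)
    refine ⟨{m} ∪ F, ⟨(Set.finite_singleton m).union hF.1, Or.inl rfl, ?_⟩, ?_⟩
    · rintro f (hf | hf)
      · obtain ⟨h1, h2, h3⟩ := (Good.singleton hT hs).2.2 f hf
        exact ⟨h1, h2, fun k a b => Or.inl (h3 k a b)⟩
      · obtain ⟨h1, h2, h3⟩ := hF.2.2 f hf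
        refine ⟨h1, h2.head hmk, fun j hj1 hj2 => ?_⟩
        rcases comparable hT hj2 h2 with h | h
        · rcases ReflTransGen.cases_tail h with h | ⟨d, h4, h5⟩
          · subst h; exact Or.inr hF.2.1
          · have := hT.2.2.1 _ _ _ hmk h5
            subst this
            rcases reflTransGen_iff_eq_or_transGen.1 hj1 with h | h
            · exact Or.inl h
            · exact (hT.2.2.2 _ (h.trans_left h4)).elim
        · exact Or.inr (h3 j h hj2)
    · intro S hS hFS n hm
      have hkS : k ∈ S := hFS (Or.inr hF.2.1)
      exact ⟨⟨k, hkS⟩, hmk, hF' S hS (Set.subset_union_right.trans hFS) n hkS⟩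
  | untl a b iha ihb =>
    obtain ⟨-, c, hmc, e, hce, he, hbet⟩ := h
    have hme : TransGen T.E m e := TransGen.head' hmc hce
    -- strict in-between nodes are below c
    have hbet' : ∀ k, TransGen T.E m k → TransGen T.E k e → k ∈ EC.sat T (trs s a) := by
      intro k hmk hke
      refine hbet k ?_ hke
      rcases comparable hT hke.to_reflTransGen hce with h | h
      · rcases ReflTransGen.cases_tail h with h | ⟨d, h4, h5⟩
        · subst h; exact ReflTransGen.refl
        · have := hT.2.2.1 _ _ _ hmc h5
          subst this
          exact (hT.2.2.2 _ (hmk.trans_left h4)).elim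
      · exact h
    have key : ∀ k, ∃ F, ReflTransGen T.E m k → ReflTransGen T.E k e → (Good T s k F ∧
        (k = e → ∀ S, Convex T S → F ⊆ S → ∀ n : S,
          ∀ hm : k ∈ S, (⟨k, hm⟩ : S) ∈ CF.sat (sub T S n) b) ∧
        (TransGen T.E m k → TransGen T.E k e → ∀ S, Convex T S → F ⊆ S → ∀ n : S,
          ∀ hm : k ∈ S, (⟨k, hm⟩ : S) ∈ CF.sat (sub T S n) a)) := by
      intro k
      by_cases hk1 : ReflTransGen T.E m k
      swap
      · exact ⟨∅, fun h => (hk1 h).elim⟩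
      by_cases hk2 : ReflTransGen T.E k e
      swap
      · exact ⟨∅, fun _ h => (hk2 h).elim⟩
      rcases reflTransGen_iff_eq_or_transGen.1 hk2 with h | h
      · subst h
        obtain ⟨F, hF, hF'⟩ := ihb e he (trs_lab T s b e he)
        exact ⟨F, fun _ _ => ⟨hF, fun _ => hF', fun _ h => (hT.2.2.2 _ h).elim⟩⟩
      have hke : k ≠ e := by
        rintro rfl; exact hT.2.2.2 _ h
      rcases reflTransGen_iff_eq_or_transGen.1 hk1 with h' | h'
      · subst h'
        exact ⟨{k}, fun _ _ => ⟨Good.singleton hT hs, fun h => (hke h).elim,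
          fun h => (hT.2.2.2 _ h).elim⟩⟩
      · have hk := hbet' k h' h
        obtain ⟨F, hF, hF'⟩ := iha k hk (trs_lab T s a k hk)
        exact ⟨F, fun _ _ => ⟨hF, fun h => (hke h).elim, fun _ _ => hF'⟩⟩
    choose F hF using key
    refine ⟨_, Good.path hT hme.to_reflTransGen F (fun k h1 h2 => (hF k h1 h2).1), ?_⟩
    intro S hS hFS n hm
    have hsub : ∀ k, ReflTransGen T.E m k → ReflTransGen T.E k e → F k ⊆ S := fun k h1 h2 =>
      (Set.subset_biUnion_of_mem (u := F) (show k ∈ {k | ReflTransGen T.E m k ∧ ReflTransGen T.E k e} from ⟨h1, h2⟩)).trans hFS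
    have hme' := hme.to_reflTransGen
    have heS : e ∈ S := hsub e hme' ReflTransGen.refl (hF e hme' ReflTransGen.refl).1.2.1
    refine ⟨⟨e, heS⟩, (sub_trans hS n _ _).2 hme, (hF e hme' ReflTransGen.refl).2.1 rfl S hS
      (hsub e hme' ReflTransGen.refl) n heS, ?_⟩
    rintro ⟨k, hkS⟩ h1 h2
    have h1' := (sub_trans hS n _ _).1 h1
    have h2' := (sub_trans hS n _ _).1 h2
    have h1r := h1'.to_reflTransGen
    have h2r := h2'.to_reflTransGen
    exact (hF k h1r h2r).2.2 h1' h2' S hS (hsub k h1r h2r) n hkS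

/-- Attach an infinite chain to every node. -/
def ext (T : RTree A) (s : A) : RTree A where
  Node := T.Node × ℕ
  E := fun x y => (x.2 = 0 ∧ y.2 = 0 ∧ T.E x.1 y.1) ∨ (x.1 = y.1 ∧ y.2 = x.2 + 1)
  root := (T.root, 0)
  label := fun x => {p | x.2 = 0 ∧ (p = s ∨ p ∈ T.label x.1)}

theorem ext_trans {T : RTree A} {s : A} {x y : T.Node × ℕ} (h : TransGen (ext T s).E x y) :
    (x.2 = 0 ∧ y.2 = 0 ∧ TransGen T.E x.1 y.1) ∨ x.2 < y.2 := by
  induction h with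
  | single h =>
    rcases h with ⟨h1, h2, h3⟩ | ⟨h1, h2⟩
    · exact Or.inl ⟨h1, h2, TransGen.single h3⟩
    · right; omega
  | tail h1 h2 ih =>
    rcases h2 with ⟨h1, h2, h3⟩ | ⟨h1, h2⟩
    · rcases ih with ⟨h4, h5, h6⟩ | h4
      · exact Or.inl ⟨h4, h2, h6.tail h3⟩
      · omega
    · right
      rcases ih with ⟨h4, h5, h6⟩ | h4 <;> omega

theorem ext_trans0 {T : RTree A} {s : A} {x y : T.Node} :
    TransGen (ext T s).E (x, 0) (y, 0) ↔ TransGen T.E x y := by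
  constructor
  · intro h
    rcases ext_trans h with h | h
    · exact h.2.2
    · exact (lt_irrefl _ h).elim
  · intro h
    exact TransGen.lift (r := T.E) (p := (ext T s).E) (fun x => (x, 0))
      (fun a b h => Or.inl ⟨rfl, rfl, h⟩) _ _ h

theorem ext_refl0 {T : RTree A} {s : A} {x y : T.Node} (h : ReflTransGen T.E x y) :
    ReflTransGen (ext T s).E (x, 0) (y, 0) :=
  ReflTransGen.lift (r := T.E) (p := (ext T s).E) (fun x => (x, 0))
      (fun a b h => Or.inl ⟨rfl, rfl, h⟩) _ _ h

theorem ext_inf {T : RTree A} (hT : T.IsTree) (s : A) : (ext T s).IsInfTree := by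
  obtain ⟨hT, hfin⟩ := hT
  refine ⟨⟨?_, ?_, ?_, ?_⟩, ?_, ?_⟩
  · rintro ⟨x, i⟩
    refine ((Set.finite_singleton s).union (hT.1 x)).subset ?_
    rintro p ⟨_, h⟩
    exact h
  · rintro ⟨x, i⟩
    induction i with
    | zero => exact ext_refl0 (hT.2.1 x)
    | succ i ih => exact ReflTransGen.tail ih (Or.inr ⟨rfl, rfl⟩)
  · rintro ⟨x, i⟩ ⟨y, j⟩ ⟨z, k⟩ h1 h2
    simp only [ext] at h1 h2
    rcases h1 with ⟨h1, h1', h1''⟩ | ⟨h1, h1'⟩ <;> rcases h2 with ⟨h2, h2', h2''⟩ | ⟨h2, h2'⟩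
    · have := hT.2.2.1 _ _ _ h1'' h2''
      subst this h1 h2; rfl
    · omega
    · omega
    · subst h1 h2
      have : j = k := by omega
      subst this; rfl
  · intro x h
    rcases ext_trans h with h | h
    · exact hT.2.2.2 _ h.2.2
    · exact lt_irrefl _ h
  · rintro ⟨x, i⟩
    exact ⟨(x, i + 1), Or.inr ⟨rfl, rfl⟩⟩
  · rintro ⟨x, i⟩
    refine ((Set.finite_univ (α := T.Node)).prod ((Set.finite_singleton 0).union
      (Set.finite_singleton (i + 1)))).subset ?_
    rintro ⟨y, j⟩ (⟨_, h, _⟩ | ⟨_, h⟩)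
    · exact ⟨trivial, Or.inl h⟩
    · exact ⟨trivial, Or.inr h⟩

theorem ext_sat {T : RTree A} (hT : T.IsPreTree) (s : A) (θ : CF A) (hs : s ∉ CF.labs θ)
    (m : T.Node) :
    ((m, 0) : T.Node × ℕ) ∈ EC.sat (ext T s) (trs s θ) ↔ m ∈ CF.sat T θ := by
  have hl : ∀ m : T.Node, s ∈ (ext T s).label (m, 0) := fun m => ⟨rfl, Or.inl rfl⟩
  have h0 : ∀ (x : T.Node × ℕ) θ, x ∈ EC.sat (ext T s) (trs s θ) → x.2 = 0 := fun x θ h =>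
    (trs_lab (ext T s) s θ x h).1
  induction θ generalizing m with
  | lab p =>
    have hp : p ≠ s := fun h => hs h.symm
    constructor
    · rintro ⟨_, _, h⟩
      exact h.resolve_left hp
    · intro h
      exact ⟨hl m, rfl, Or.inr h⟩
  | nlab p =>
    have hp : p ≠ s := fun h => hs h.symm
    constructor
    · rintro ⟨_, h⟩ h'
      exact h ⟨rfl, Or.inr h'⟩
    · intro h
      refine ⟨hl m, ?_⟩
      rintro ⟨_, h'⟩
      exact h (h'.resolve_left hp)
  | top => exact ⟨fun _ => trivial, fun _ => ⟨hl m, trivial⟩⟩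
  | and a b iha ihb =>
    exact and_congr (iha (fun h => hs (Or.inl h)) m) (ihb (fun h => hs (Or.inr h)) m)
  | or a b iha ihb =>
    exact or_congr (iha (fun h => hs (Or.inl h)) m) (ihb (fun h => hs (Or.inr h)) m)
  | ex a ih =>
    constructor
    · rintro ⟨_, ⟨k, i⟩, h1, h2⟩
      have hi : i = 0 := h0 _ _ h2
      subst hi
      refine ⟨k, ?_, (ih hs k).1 h2⟩
      rcases h1 with h1 | h1
      · exact h1.2.2
      · exact absurd h1.2 (by simp)
    · rintro ⟨k, h1, h2⟩
      exact ⟨hl m, (k, 0), Or.inl ⟨rfl, rfl, h1⟩, (ih hs k).2 h2⟩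
  | untl a b iha ihb =>
    have iha := iha (fun h => hs (Or.inl h))
    have ihb := ihb (fun h => hs (Or.inr h))
    constructor
    · rintro ⟨_, c, hmc, ⟨e, i⟩, hce, he, hbet⟩
      have hi : i = 0 := h0 _ _ he
      subst hi
      have hme := ext_trans0.1 (TransGen.head' hmc hce)
      have hc : c.2 = 0 := by
        rcases reflTransGen_iff_eq_or_transGen.1 hce with h | h
        · rw [← h]
        · rcases ext_trans h with h | h
          · exact h.1
          · exact absurd h (by simp)
      obtain ⟨c, j⟩ := c
      simp only at hc
      subst hc
      have hmc' : T.E m c := by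
        rcases hmc with h1 | h1
        · exact h1.2.2
        · exact absurd h1.2 (by simp)
      have hce' : ReflTransGen T.E c e := by
        rcases reflTransGen_iff_eq_or_transGen.1 hce with h | h
        · have : e = c := congrArg Prod.fst h
          subst this; exact ReflTransGen.refl
        · exact (ext_trans0.1 h).to_reflTransGen
      refine ⟨e, hme, (ihb e).1 he, fun k hmk hke => (iha k).1 (hbet (k, 0) ?_ (ext_trans0.2 hke))⟩
      apply ext_refl0
      rcases comparable hT hke.to_reflTransGen hce' with h | h
      · rcases ReflTransGen.cases_tail h with h | ⟨d, h4, h5⟩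
        · subst h; exact ReflTransGen.refl
        · have := hT.2.2.1 _ _ _ hmc' h5
          subst this
          exact (hT.2.2.2 _ (hmk.trans_left h4)).elim
      · exact h
    · rintro ⟨e, hme, he, hbet⟩
      obtain ⟨c, hmc, hce⟩ := TransGen.head'_iff.1 hme
      refine ⟨hl m, (c, 0), Or.inl ⟨rfl, rfl, hmc⟩, (e, 0), ext_refl0 hce, (ihb e).2 he, ?_⟩
      rintro ⟨k, i⟩ h1 h2
      have hi : i = 0 := by
        rcases ext_trans h2 with h | h
        · exact h.1
        · exact absurd h (by simp)
      subst hi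
      refine (iha k).2 (hbet k (TransGen.head' hmc ?_) (ext_trans0.1 h2))
      rcases reflTransGen_iff_eq_or_transGen.1 h1 with h | h
      · have : k = c := congrArg Prod.fst h
        subst this; exact ReflTransGen.refl
      · exact (ext_trans0.1 h).to_reflTransGen

end CtpAux

/-- reduction of CTP^{¬,∨} containment to containment over
infinite trees: for CTP^{¬,∨} node formulas φ, ψ and a label s occurring in
neither, φ is contained in ψ over finite multi-labeled trees iff φ^s is
contained in ψ^s over infinite finitely branching multi-labeled trees. -/
theorem ctp_to_ectl_containment [Infinite A] (φ ψ : CF A) (s : A)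
    (hsφ : s ∉ CF.labs φ) (hsψ : s ∉ CF.labs ψ) :
    (∀ T : RTree A, T.IsTree →
        ∀ n : T.Node, n ∈ CF.sat T φ → n ∈ CF.sat T ψ) ↔
    (∀ T : RTree A, T.IsInfTree →
        ∀ n : T.Node, n ∈ EC.sat T (trs s φ) → n ∈ EC.sat T (trs s ψ)) := by
  constructor
  · intro H T hT n hn
    obtain ⟨F, hF, hF'⟩ := CtpAux.down hT.1 s φ n hn
    have h1 := hF' F hF.convex subset_rfl ⟨n, hF.2.1⟩ hF.2.1
    have h2 := H _ (CtpAux.sub_isTree hT.1 hF.convex hF.1 ⟨n, hF.2.1⟩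
      (fun a ha => (hF.2.2 a ha).2.1)) _ h1
    exact CtpAux.up hF.convex _ s (fun a ha => (hF.2.2 a ha).1) ψ _ h2
  · intro H T hT n hn
    exact (CtpAux.ext_sat hT.1 s ψ hsψ n).1
      (H _ (CtpAux.ext_inf hT s) (n, 0) ((CtpAux.ext_sat hT.1 s φ hsφ n).2 hn))
end

section
/- Relativization lemma: let T=(N,E,r,ρ) be a finite multi-labeled tree, θ a CTP^{¬,∨} node formula, and s a label occurring neither in θ nor in the labels of T. Let T^s_∞ be the infinite tree obtained from T by adding s to the label set of every node of T and attaching below every leaf of T an infinite path of new nodes with empty label sets. Then for every node n∈N: T,n⊨θ if and only if T^s_∞,n⊨θ^s, where (·)^s is the translation defined by ⊤^s = s∧⊤; p^s = s∧p; (¬p)^s = s∧¬p; (θ∧σ)^s = θ^s∧σ^s; (θ∨σ)^s = θ^s∨σ^s; (⟨↓⟩θ)^s = s∧∃Xθ^s; (U(σ,θ))^s = s∧∃X∃(σ^s U θ^s). -/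
variable {A : Type}

/-- The infinite tree T^s_∞ obtained from a finite tree T by adding the label s
to every node of T and attaching an infinite path of nodes with empty label
sets below every leaf of T. -/
def infExt (T : RTree A) (s : A) : RTree A where
  Node := T.Node ⊕ ({l : T.Node // ∀ m, ¬ T.E l m} × ℕ)
  E a b :=
    match a, b with
    | .inl a, .inl b => T.E a b
    | .inl a, .inr (l, i) => l.1 = a ∧ i = 0
    | .inr (l, i), .inr (l', j) => l = l' ∧ j = i + 1
    | .inr _, .inl _ => False
  root := .inl T.root
  label n :=
    match n with
    | .inl a => insert s (T.label a)
    | .inr _ => ∅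

theorem infExt_rtg_inl {T : RTree A} {s : A} {x : (infExt T s).Node} {b : T.Node}
    (h : Relation.ReflTransGen (infExt T s).E x (Sum.inl b)) :
    ∃ a, x = Sum.inl a ∧ Relation.ReflTransGen T.E a b := by
  induction h using Relation.ReflTransGen.head_induction_on with
  | refl => exact ⟨b, rfl, .refl⟩
  | head h1 h2 ih =>
    rename_i u v
    obtain ⟨a, rfl, ha⟩ := ih
    rcases u with u | u
    · exact ⟨u, rfl, .head h1 ha⟩
    · exact h1.elim

theorem infExt_tg_inl {T : RTree A} {s : A} {x : (infExt T s).Node} {b : T.Node}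
    (h : Relation.TransGen (infExt T s).E x (Sum.inl b)) :
    ∃ a, x = Sum.inl a ∧ Relation.TransGen T.E a b := by
  obtain ⟨c, h1, h2⟩ := Relation.TransGen.head'_iff.1 h
  obtain ⟨c, rfl, h3⟩ := infExt_rtg_inl h2
  rcases x with u | u
  · exact ⟨u, rfl, Relation.TransGen.head' h1 h3⟩
  · exact h1.elim

theorem infExt_rtg {T : RTree A} (s : A) {a b : T.Node}
    (h : Relation.ReflTransGen T.E a b) :
    Relation.ReflTransGen (infExt T s).E (Sum.inl a) (Sum.inl b) :=
  Relation.ReflTransGen.lift (p := (infExt T s).E) Sum.inl (fun _ _ h => h) _ _ h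

theorem infExt_tg {T : RTree A} (s : A) {a b : T.Node}
    (h : Relation.TransGen T.E a b) :
    Relation.TransGen (infExt T s).E (Sum.inl a) (Sum.inl b) :=
  Relation.TransGen.lift (p := (infExt T s).E) Sum.inl (fun _ _ h => h) _ _ h

theorem trs_inl {T : RTree A} {s : A} (θ : CF A) (x : (infExt T s).Node)
    (h : x ∈ EC.sat (infExt T s) (trs s θ)) : ∃ a, x = Sum.inl a := by
  have key : s ∈ (infExt T s).label x → ∃ a, x = Sum.inl a := by
    rcases x with a | a
    · exact fun _ => ⟨a, rfl⟩
    · exact fun h => h.elim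
  induction θ with
  | and φ ψ ih _ => exact ih h.1
  | or φ ψ ih ih' => exact h.elim ih ih'
  | _ => exact key h.1

theorem child_unique {T : RTree A} (hT : T.IsPreTree) {n c d : T.Node}
    (hc : T.E n c) (hd : T.E n d) (h : Relation.ReflTransGen T.E c d) : c = d := by
  rcases Relation.ReflTransGen.cases_tail h with h | ⟨e, h1, h2⟩
  · exact h.symm
  · have := hT.2.2.1 _ _ _ hd h2
    subst this
    exact (hT.2.2.2 _ (Relation.TransGen.head' hc h1)).elim

theorem child_eq {T : RTree A} (hT : T.IsPreTree) {n c d m : T.Node}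
    (hc : T.E n c) (hd : T.E n d) (h : Relation.ReflTransGen T.E c m)
    (h' : Relation.ReflTransGen T.E d m) : c = d := by
  have hu : Relator.RightUnique (Function.swap T.E) := fun a b c h1 h2 => hT.2.2.1 _ _ _ h1 h2
  rcases Relation.ReflTransGen.total_of_right_unique hu
    (Relation.reflTransGen_swap.2 h) (Relation.reflTransGen_swap.2 h') with h | h
  · exact (child_unique hT hd hc (Relation.reflTransGen_swap.1 h)).symm
  · exact child_unique hT hc hd (Relation.reflTransGen_swap.1 h)

/-- relativization lemma: for a finite multi-labeled tree T, a
CTP^{¬,∨} node formula θ and a label s occurring neither in θ nor in T, a node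
n of T satisfies θ in T iff it satisfies θ^s in T^s_∞. -/
theorem ctp_relativization (T : RTree A) (hT : T.IsTree) (θ : CF A) (s : A)
    (hsθ : s ∉ CF.labs θ) (hsT : ∀ n : T.Node, s ∉ T.label n) :
    ∀ n : T.Node, n ∈ CF.sat T θ ↔
      (Sum.inl n : (infExt T s).Node) ∈ EC.sat (infExt T s) (trs s θ) := by
  have hs : ∀ n : T.Node, (Sum.inl n : (infExt T s).Node) ∈ EC.sat (infExt T s) (.lab s) :=
    fun n => Set.mem_insert _ _
  have hl : ∀ (n : T.Node) p, p ≠ s → (p ∈ T.label n ↔ p ∈ (infExt T s).label (Sum.inl n)) :=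
    fun n p hp => ⟨fun h => Or.inr h, fun h => h.resolve_left hp⟩
  induction θ with
  | lab p =>
    intro n
    have := hl n p (fun h => hsθ h.symm)
    exact ⟨fun h => ⟨hs n, this.1 h⟩, fun h => this.2 h.2⟩
  | nlab p =>
    intro n
    have := hl n p (fun h => hsθ h.symm)
    exact ⟨fun h => ⟨hs n, fun h' => h (this.2 h')⟩, fun h h' => h.2 (this.1 h')⟩
  | top => exact fun n => ⟨fun _ => ⟨hs n, trivial⟩, fun _ => trivial⟩
  | and φ ψ ih ih' =>
    exact fun n => and_congr (ih (fun h => hsθ (Or.inl h)) n) (ih' (fun h => hsθ (Or.inr h)) n)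
  | or φ ψ ih ih' =>
    exact fun n => or_congr (ih (fun h => hsθ (Or.inl h)) n) (ih' (fun h => hsθ (Or.inr h)) n)
  | ex φ ih =>
    intro n
    constructor
    · rintro ⟨m, h1, h2⟩
      exact ⟨hs n, Sum.inl m, h1, (ih hsθ m).1 h2⟩
    · rintro ⟨_, m, h1, h2⟩
      obtain ⟨m, rfl⟩ := trs_inl φ m h2
      exact ⟨m, h1, (ih hsθ m).2 h2⟩
  | untl σ φ ih ih' =>
    have ih := ih (fun h => hsθ (Or.inl h))
    have ih' := ih' (fun h => hsθ (Or.inr h))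
    intro n
    constructor
    · rintro ⟨m, h1, h2, h3⟩
      obtain ⟨c, hc, hcm⟩ := Relation.TransGen.head'_iff.1 h1
      refine ⟨hs n, Sum.inl c, hc, Sum.inl m, infExt_rtg s hcm, (ih' m).1 h2, ?_⟩
      intro k hk1 hk2
      obtain ⟨k, rfl, hk3⟩ := infExt_tg_inl hk2
      obtain ⟨c', hc', hk4⟩ := infExt_rtg_inl hk1
      obtain rfl := Sum.inl.inj hc'
      exact (ih k).1 (h3 k (Relation.TransGen.head' hc hk4) hk3)
    · rintro ⟨_, c, hc, m, hcm, h2, h3⟩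
      obtain ⟨m, rfl⟩ := trs_inl φ m h2
      obtain ⟨c, rfl, hcm'⟩ := infExt_rtg_inl hcm
      refine ⟨m, Relation.TransGen.head' hc hcm', (ih' m).2 h2, ?_⟩
      intro k hk1 hk2
      obtain ⟨d, hd, hdk⟩ := Relation.TransGen.head'_iff.1 hk1
      obtain rfl := child_eq hT.1 hc hd hcm' (hdk.trans hk2.to_reflTransGen)
      exact (ih k).2 (h3 _ (infExt_rtg s hdk) (infExt_tg s hk2))
end
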